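/- (Strong consistency of the CLS estimator.) Let (X_t)_{t≥0} be the canonical stationary BAR(1) chain with true parameters (ρ, p). Then μ-almost surely, the CLS estimators computed from X_0,…,X_n satisfy ρ̂_n → ρ and p̂_n → p as n → ∞ (the estimators being defined arbitrarily on the event, of vanishing probability for large n, where a defining denominator is zero). -/

import Mathlib

open MeasureTheory Filter Finset Matrix

noncomputable section

/-- BAR(1) one-step transition probability `K(i,{j})` with parameters `(ρ, p)`,
where `β = p(1-ρ)` and `α = β + ρ`. -/
def barK (N : ℕ) (ρ p : ℝ) (i j : ℕ) : ℝ :=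
  ∑ k ∈ Finset.Icc (i + j - N) (min i j),
    (Nat.choose i k : ℝ) * (Nat.choose (N - i) (j - k)) *
      (p * (1 - ρ) + ρ) ^ k * (1 - (p * (1 - ρ) + ρ)) ^ (i - k) *
      (p * (1 - ρ)) ^ (j - k) * (1 - p * (1 - ρ)) ^ (N + k - (i + j))

/-- Binomial(N,p) probability mass function. -/
def binomPMF (N : ℕ) (p : ℝ) (i : ℕ) : ℝ :=
  (Nat.choose N i : ℝ) * p ^ i * (1 - p) ^ (N - i)

/-- CLS estimator of ρ from observations `x 0, …, x n`. -/
def clsRho (x : ℕ → ℝ) (n : ℕ) : ℝ :=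
  ((n : ℝ) * ∑ t ∈ Finset.Icc 1 n, x t * x (t - 1)
      - (∑ t ∈ Finset.Icc 1 n, x t) * (∑ t ∈ Finset.Icc 1 n, x (t - 1))) /
    ((n : ℝ) * ∑ t ∈ Finset.Icc 1 n, (x (t - 1)) ^ 2
      - (∑ t ∈ Finset.Icc 1 n, x (t - 1)) ^ 2)

/-- CLS estimator of p from observations `x 0, …, x n`. -/
def clsP (N : ℕ) (x : ℕ → ℝ) (n : ℕ) : ℝ :=
  ((∑ t ∈ Finset.Icc 1 n, x t) - clsRho x n * ∑ t ∈ Finset.Icc 1 n, x (t - 1)) /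
    ((n : ℝ) * N * (1 - clsRho x n))

/-- The real-valued observation sequence attached to a trajectory `ω`. -/
def xR (ω : ℕ → ℕ) (t : ℕ) : ℝ := (ω t : ℝ)

/-- Conditional variance σ²(i) of the BAR(1) model. -/
def sigmaSq (N : ℕ) (ρ p : ℝ) (i : ℕ) : ℝ :=
  ρ * (1 - ρ) * (1 - 2 * p) * i + N * p * (1 - ρ) * (1 - p * (1 - ρ))

/-- The matrix `W_CLS`. -/
def Wcls (N : ℕ) (ρ p : ℝ) : Matrix (Fin 2) (Fin 2) ℝ :=
  !![∑ i ∈ Finset.range (N + 1), binomPMF N p i * ((i : ℝ) - N * p) ^ 2 * sigmaSq N ρ p i,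
     (N : ℝ) * (1 - ρ) *
       ∑ i ∈ Finset.range (N + 1), binomPMF N p i * ((i : ℝ) - N * p) * sigmaSq N ρ p i;
     (N : ℝ) * (1 - ρ) *
       ∑ i ∈ Finset.range (N + 1), binomPMF N p i * ((i : ℝ) - N * p) * sigmaSq N ρ p i,
     (N : ℝ) ^ 2 * (1 - ρ) ^ 2 * ∑ i ∈ Finset.range (N + 1), binomPMF N p i * sigmaSq N ρ p i]

section Helpers

open Polynomial in
lemma coeff_lin_pow (a b : ℝ) (n k : ℕ) :
    ((C a * X + C b) ^ n : ℝ[X]).coeff k = (Nat.choose n k : ℝ) * a ^ k * b ^ (n - k) := by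
  rw [add_pow, finsetSum_coeff]
  have h : ∀ m ∈ Finset.range (n + 1),
      ((C a * X) ^ m * C b ^ (n - m) * (Nat.choose n m : ℝ[X])).coeff k =
        if k = m then (Nat.choose n k : ℝ) * a ^ k * b ^ (n - k) else 0 := by
    intro m _
    have : ((C a * X) ^ m * C b ^ (n - m) * (Nat.choose n m : ℝ[X])) =
        C ((Nat.choose n m : ℝ) * a ^ m * b ^ (n - m)) * X ^ m := by
      simp only [map_mul, map_pow, map_natCast, mul_pow]
      ring
    rw [this, coeff_C_mul_X_pow]
    split_ifs with hk
    · rw [hk]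
    · rfl
  rw [Finset.sum_congr rfl h]
  rw [Finset.sum_ite_eq]
  split_ifs with hk
  · rfl
  · have : n < k := by simpa using hk
    simp [Nat.choose_eq_zero_of_lt this]

open Polynomial in
def barPoly (N : ℕ) (ρ p : ℝ) (i : ℕ) : ℝ[X] :=
  (C (p * (1 - ρ) + ρ) * X + C (1 - (p * (1 - ρ) + ρ))) ^ i *
    (C (p * (1 - ρ)) * X + C (1 - p * (1 - ρ))) ^ (N - i)

lemma barK_eq_coeff (N : ℕ) (ρ p : ℝ) (i j : ℕ) (hi : i ≤ N) :
    barK N ρ p i j = (barPoly N ρ p i).coeff j := by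
  unfold barK barPoly
  rw [Polynomial.coeff_mul, Finset.Nat.sum_antidiagonal_eq_sum_range_succ_mk]
  symm
  rw [← Finset.sum_subset (s₁ := Finset.Icc (i + j - N) (min i j))]
  · apply Finset.sum_congr rfl
    intro k hk
    simp only [Finset.mem_Icc, le_min_iff] at hk
    simp only [coeff_lin_pow]
    have : N - i - (j - k) = N + k - (i + j) := by omega
    rw [this]
    ring
  · intro k hk
    simp only [Finset.mem_Icc, le_min_iff, Finset.mem_range] at hk ⊢
    omega
  · intro k hk hk'
    simp only [Finset.mem_Icc, le_min_iff, Finset.mem_range] at hk hk'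
    simp only [coeff_lin_pow]
    by_cases h : i < k
    · simp [Nat.choose_eq_zero_of_lt h]
    · have : N - i < j - k := by omega
      simp [Nat.choose_eq_zero_of_lt this]

lemma barPoly_natDegree (N : ℕ) (ρ p : ℝ) (i : ℕ) (hi : i ≤ N) :
    (barPoly N ρ p i).natDegree < N + 1 := by
  unfold barPoly
  have h1 := Polynomial.natDegree_mul_le
    (p := (Polynomial.C (p * (1 - ρ) + ρ) * Polynomial.X + Polynomial.C (1 - (p * (1 - ρ) + ρ))) ^ i)
    (q := (Polynomial.C (p * (1 - ρ)) * Polynomial.X + Polynomial.C (1 - p * (1 - ρ))) ^ (N - i))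
  have h2 := Polynomial.natDegree_pow_le_of_le i
    (Polynomial.natDegree_linear_le (a := p * (1 - ρ) + ρ) (b := 1 - (p * (1 - ρ) + ρ)))
  have h3 := Polynomial.natDegree_pow_le_of_le (N - i)
    (Polynomial.natDegree_linear_le (a := p * (1 - ρ)) (b := 1 - p * (1 - ρ)))
  omega

lemma barK_zero (N : ℕ) (ρ p : ℝ) (i j : ℕ) (hi : i ≤ N) (hj : N < j) :
    barK N ρ p i j = 0 := by
  rw [barK_eq_coeff _ _ _ _ _ hi]
  apply Polynomial.coeff_eq_zero_of_natDegree_lt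
  have := barPoly_natDegree N ρ p i hi
  omega

lemma barK_sum (N : ℕ) (ρ p : ℝ) (i : ℕ) (hi : i ≤ N) :
    ∑ j ∈ Finset.range (N + 1), barK N ρ p i j = 1 := by
  have h := Polynomial.eval_eq_sum_range' (barPoly_natDegree N ρ p i hi) 1
  simp only [one_pow, mul_one] at h
  rw [Finset.sum_congr rfl (fun j _ => barK_eq_coeff N ρ p i j hi), ← h]
  simp [barPoly]

/-- derivative sums -/
lemma poly_sum_deriv (P : Polynomial ℝ) (N : ℕ) (h : P.natDegree < N + 1) :
    ∑ j ∈ Finset.range (N + 1), P.coeff j * (j : ℝ) = (Polynomial.derivative P).eval 1 := by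
  conv_rhs => rw [P.as_sum_range' (N + 1) h]
  rw [Polynomial.derivative_sum, Polynomial.eval_finsetSum]
  apply Finset.sum_congr rfl
  intro j _
  simp [Polynomial.derivative_monomial]

lemma poly_sum_deriv2 (P : Polynomial ℝ) (N : ℕ) (h : P.natDegree < N + 1) :
    ∑ j ∈ Finset.range (N + 1), P.coeff j * ((j : ℝ) ^ 2 - j) =
      (Polynomial.derivative (Polynomial.derivative P)).eval 1 := by
  conv_rhs => rw [P.as_sum_range' (N + 1) h]
  rw [Polynomial.derivative_sum, Polynomial.derivative_sum, Polynomial.eval_finsetSum]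
  apply Finset.sum_congr rfl
  intro j _
  rcases j with _ | j
  · simp
  · simp [Polynomial.derivative_monomial]
    ring

lemma barK_sum1 (N : ℕ) (ρ p : ℝ) (i : ℕ) (hi : i ≤ N) :
    ∑ j ∈ Finset.range (N + 1), barK N ρ p i j * (j : ℝ) = ρ * i + N * p * (1 - ρ) := by
  rw [Finset.sum_congr rfl (fun j _ => by rw [barK_eq_coeff N ρ p i j hi]),
    poly_sum_deriv _ _ (barPoly_natDegree N ρ p i hi)]
  obtain ⟨m, rfl⟩ := Nat.exists_eq_add_of_le hi
  simp [barPoly, Polynomial.derivative_mul, Polynomial.derivative_pow]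
  ring

lemma barK_sum2 (N : ℕ) (ρ p : ℝ) (i : ℕ) (hi : i ≤ N) :
    ∑ j ∈ Finset.range (N + 1), barK N ρ p i j * ((j : ℝ) ^ 2 - j) =
      (i : ℝ) * (i - 1) * (p * (1 - ρ) + ρ) ^ 2
      + 2 * i * (N - i) * (p * (1 - ρ) + ρ) * (p * (1 - ρ))
      + ((N : ℝ) - i) * (N - i - 1) * (p * (1 - ρ)) ^ 2 := by
  rw [Finset.sum_congr rfl (fun j _ => by rw [barK_eq_coeff N ρ p i j hi]),
    poly_sum_deriv2 _ _ (barPoly_natDegree N ρ p i hi)]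
  obtain ⟨m, rfl⟩ := Nat.exists_eq_add_of_le hi
  rcases i with _ | i <;> rcases m with _ | m <;>
  simp [barPoly, Polynomial.derivative_mul, Polynomial.derivative_pow] <;>
  ring

/-- Bounded sequence of partial sums: from the subsequence of squares to all. -/
lemma fill_squares (D : ℕ → ℝ) (C : ℝ) (hC : ∀ t, |D t| ≤ C)
    (h : Tendsto (fun k : ℕ => (∑ t ∈ Finset.range (k ^ 2), D t) / (k : ℝ) ^ 2) atTop (nhds 0)) :
    Tendsto (fun n : ℕ => (∑ t ∈ Finset.range n, D t) / (n : ℝ)) atTop (nhds 0) := by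
  have hC0 : 0 ≤ C := (abs_nonneg _).trans (hC 0)
  have hk : Tendsto Nat.sqrt atTop atTop := by
    apply tendsto_atTop.2
    intro b
    filter_upwards [eventually_ge_atTop (b * b)] with n hn
    exact Nat.le_sqrt.2 hn
  have h1 := (h.abs).comp hk
  have h2 : Tendsto (fun k : ℕ => 2 * C / (k : ℝ)) atTop (nhds 0) :=
    tendsto_const_div_atTop_nhds_zero_nat _
  have h3 := h1.add (h2.comp hk)
  simp only [abs_zero, add_zero] at h3
  apply squeeze_zero_norm' _ h3
  filter_upwards [eventually_ge_atTop 1] with n hn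
  simp only [Function.comp]
  set k := Nat.sqrt n with hkdef
  have hk1 : k ^ 2 ≤ n := by rw [pow_two]; exact Nat.sqrt_le n
  have hk2 : n ≤ k ^ 2 + 2 * k := by
    have := Nat.sqrt_le_add n
    rw [← hkdef] at this
    nlinarith
  have hk0 : 1 ≤ k := Nat.le_sqrt.2 (by simpa using hn)
  have hkR : (1 : ℝ) ≤ k := by exact_mod_cast hk0
  have hk1R : (k : ℝ) ^ 2 ≤ n := by exact_mod_cast hk1
  have hsplit : ∑ t ∈ Finset.range n, D t =
      ∑ t ∈ Finset.range (k ^ 2), D t + ∑ t ∈ Finset.Ico (k ^ 2) n, D t := by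
    rw [Finset.sum_range_add_sum_Ico _ hk1]
  have hb : |∑ t ∈ Finset.Ico (k ^ 2) n, D t| ≤ 2 * k * C := by
    calc |∑ t ∈ Finset.Ico (k ^ 2) n, D t| ≤ ∑ t ∈ Finset.Ico (k ^ 2) n, |D t| :=
          Finset.abs_sum_le_sum_abs _ _
      _ ≤ ∑ t ∈ Finset.Ico (k ^ 2) n, C := Finset.sum_le_sum (fun t _ => hC t)
      _ = ((n - k ^ 2 : ℕ) : ℝ) * C := by simp
      _ ≤ 2 * k * C := by
        apply mul_le_mul_of_nonneg_right _ hC0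
        have : n - k ^ 2 ≤ 2 * k := by omega
        exact_mod_cast this
  have hkpos : (0 : ℝ) < (k : ℝ) ^ 2 := by positivity
  rw [Real.norm_eq_abs, abs_div, abs_div, abs_of_pos (lt_of_lt_of_le hkpos hk1R), abs_of_pos hkpos]
  calc |∑ t ∈ Finset.range n, D t| / (n : ℝ) ≤ |∑ t ∈ Finset.range n, D t| / (k : ℝ) ^ 2 := by
        gcongr
    _ ≤ (|∑ t ∈ Finset.range (k ^ 2), D t| + 2 * k * C) / (k : ℝ) ^ 2 := by
        gcongr
        rw [hsplit]
        exact (abs_add_le _ _).trans (by gcongr)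
    _ = _ := by
        field_simp

/-- Strong law for bounded variables with linear growth of second moments. -/
lemma slln_of_second_moment {Ω : Type*} [MeasurableSpace Ω] (μ : Measure Ω)
    (D : ℕ → Ω → ℝ) (hm : ∀ t, Measurable (D t)) (C : ℝ)
    (hC : ∀ t ω, |D t ω| ≤ C)
    (hint : ∀ n, Integrable (fun ω => (∑ t ∈ Finset.range n, D t ω) ^ 2) μ)
    (hS : ∀ n : ℕ, ∫ ω, (∑ t ∈ Finset.range n, D t ω) ^ 2 ∂μ ≤ C ^ 2 * n) :
    ∀ᵐ ω ∂μ, Tendsto (fun n : ℕ => (∑ t ∈ Finset.range n, D t ω) / (n : ℝ)) atTop (nhds 0) := by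
  have hmeas : ∀ n, Measurable (fun ω => ∑ t ∈ Finset.range n, D t ω) := fun n =>
    Finset.measurable_sum _ (fun t _ => hm t)
  set F : ℕ → Ω → ENNReal := fun k ω =>
    ENNReal.ofReal (((∑ t ∈ Finset.range (k ^ 2), D t ω) / (k : ℝ) ^ 2) ^ 2) with hF
  have hFm : ∀ k, Measurable (F k) := fun k =>
    (((hmeas (k ^ 2)).div_const _).pow_const 2).ennreal_ofReal
  have hle : ∀ k, ∫⁻ ω, F k ω ∂μ ≤ ENNReal.ofReal (C ^ 2 * (1 / (k : ℝ) ^ 2)) := by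
    intro k
    simp only [hF, div_pow]
    rw [← ofReal_integral_eq_lintegral_ofReal]
    · apply ENNReal.ofReal_le_ofReal
      rw [integral_div]
      have := hS (k ^ 2)
      rcases Nat.eq_zero_or_pos k with hk | hk
      · subst hk; simp
      · have hkR : (0 : ℝ) < k := by exact_mod_cast hk
        push_cast at this
        rw [div_le_iff₀ (by positivity)]
        refine this.trans (le_of_eq ?_)
        field_simp
    · exact (hint _).div_const _
    · exact Filter.Eventually.of_forall (fun ω => by positivity)
  have hsum : Summable (fun k : ℕ => C ^ 2 * (1 / (k : ℝ) ^ 2)) :=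
    (Real.summable_one_div_nat_pow.2 (by norm_num)).mul_left _
  have htot : ∫⁻ ω, ∑' k, F k ω ∂μ ≠ ⊤ := by
    rw [lintegral_tsum (fun k => (hFm k).aemeasurable)]
    refine ne_top_of_le_ne_top ?_ (ENNReal.tsum_le_tsum hle)
    rw [← ENNReal.ofReal_tsum_of_nonneg (fun k => by positivity) hsum]
    exact ENNReal.ofReal_ne_top
  have hae := ae_lt_top (Measurable.tsum hFm) htot
  filter_upwards [hae] with ω hω
  apply fill_squares _ C (fun t => hC t ω)
  have h0 := ENNReal.tendsto_atTop_zero_of_tsum_ne_top hω.ne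
  have h1 := (ENNReal.tendsto_toReal (a := 0) (by simp)).comp h0
  have h2 : Tendsto (fun k : ℕ => ((∑ t ∈ Finset.range (k ^ 2), D t ω) / (k : ℝ) ^ 2) ^ 2)
      atTop (nhds 0) := by
    refine h1.congr (fun k => ?_)
    simp only [Function.comp, hF]
    rw [ENNReal.toReal_ofReal (by positivity)]
  have h3 := h2.sqrt
  rw [Real.sqrt_zero] at h3
  rw [tendsto_zero_iff_abs_tendsto_zero]
  refine h3.congr (fun k => ?_)
  simp [Real.sqrt_sq_eq_abs]

lemma barK_nonneg (N : ℕ) (ρ p : ℝ) (i j : ℕ) (h1 : 0 ≤ p * (1 - ρ) + ρ)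
    (h2 : 0 ≤ 1 - (p * (1 - ρ) + ρ)) (h3 : 0 ≤ p * (1 - ρ)) (h4 : 0 ≤ 1 - p * (1 - ρ)) :
    0 ≤ barK N ρ p i j := by
  unfold barK
  apply Finset.sum_nonneg
  intro k _
  generalize p * (1 - ρ) + ρ = a at *
  generalize 1 - a = a' at *
  generalize 1 - p * (1 - ρ) = b' at *
  generalize p * (1 - ρ) = b at *
  positivity

def cyl (n : ℕ) (x : ℕ → ℕ) : Set (ℕ → ℕ) := {ω | ∀ t ≤ n, ω t = x t}

lemma measurableSet_cyl (n : ℕ) (x : ℕ → ℕ) : MeasurableSet (cyl n x) := by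
  have : cyl n x = ⋂ t, ⋂ (_ : t ≤ n), (fun ω : ℕ → ℕ => ω t) ⁻¹' {x t} := by
    ext ω; simp [cyl]
  rw [this]
  exact MeasurableSet.iInter fun t => MeasurableSet.iInter fun _ =>
    measurable_pi_apply t (measurableSet_singleton _)

def extZ (n : ℕ) (y : Fin (n + 1) → ℕ) (t : ℕ) : ℕ := if h : t < n + 1 then y ⟨t, h⟩ else 0

lemma mem_cyl_extZ (n : ℕ) (ω : ℕ → ℕ) : ω ∈ cyl n (extZ n (fun i => ω i)) := by
  intro t ht
  simp [extZ, Nat.lt_succ_of_le ht]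

lemma cyl_extZ_disjoint (n : ℕ) : Pairwise (Function.onFun Disjoint fun y => cyl n (extZ n y)) := by
  intro y z hyz
  rw [Function.onFun, Set.disjoint_left]
  intro ω h1 h2
  apply hyz
  funext i
  have a := h1 i (Nat.le_of_lt_succ i.2)
  have b := h2 i (Nat.le_of_lt_succ i.2)
  simp only [extZ, i.2, dif_pos] at a b
  exact a.symm.trans b

lemma iUnion_cyl_extZ (n : ℕ) : (⋃ y, cyl n (extZ n y)) = Set.univ :=
  Set.eq_univ_of_forall fun ω => Set.mem_iUnion.2 ⟨_, mem_cyl_extZ n ω⟩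

lemma path_zero (N : ℕ) (ρ p : ℝ) (n : ℕ) (x : ℕ → ℕ) (h : ∃ t ≤ n, N < x t) :
    binomPMF N p (x 0) * ∏ t ∈ Finset.Icc 1 n, barK N ρ p (x (t - 1)) (x t) = 0 := by
  classical
  have hs := Nat.find_spec h
  have hmin : ∀ m < Nat.find h, ¬ (m ≤ n ∧ N < x m) := fun m hm => Nat.find_min h hm
  set t := Nat.find h
  rcases Nat.eq_zero_or_pos t with h0 | h0
  · rw [h0] at hs
    simp [binomPMF, Nat.choose_eq_zero_of_lt hs.2]
  · have := hmin (t - 1) (by omega)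
    rw [Finset.prod_eq_zero (i := t) (by simp; omega), mul_zero]
    apply barK_zero _ _ _ _ _ _ hs.2
    by_contra hcon
    exact this ⟨by omega, by omega⟩

lemma cyl_null (N : ℕ) (p ρ : ℝ) (μ : Measure (ℕ → ℕ))
    (hμ : ∀ (n : ℕ) (x : ℕ → ℕ),
      μ {ω | ∀ t ≤ n, ω t = x t} =
        ENNReal.ofReal (binomPMF N p (x 0) *
          ∏ t ∈ Finset.Icc 1 n, barK N ρ p (x (t - 1)) (x t)))
    (n : ℕ) (x : ℕ → ℕ) (h : ∃ t ≤ n, N < x t) : μ (cyl n x) = 0 := by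
  unfold cyl
  rw [hμ, path_zero N ρ p n x h, ENNReal.ofReal_zero]

lemma ae_le_N (N : ℕ) (p ρ : ℝ) (μ : Measure (ℕ → ℕ))
    (hμ : ∀ (n : ℕ) (x : ℕ → ℕ),
      μ {ω | ∀ t ≤ n, ω t = x t} =
        ENNReal.ofReal (binomPMF N p (x 0) *
          ∏ t ∈ Finset.Icc 1 n, barK N ρ p (x (t - 1)) (x t)))
    : ∀ᵐ ω ∂μ, ∀ t, ω t ≤ N := by
  have h : ∀ᵐ ω ∂μ, ∀ n : ℕ, ∀ y : Fin (n + 1) → ℕ, (∃ t ≤ n, N < extZ n y t) →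
      ω ∉ cyl n (extZ n y) := by
    rw [ae_all_iff]; intro n
    rw [ae_all_iff]; intro y
    by_cases hy : ∃ t ≤ n, N < extZ n y t
    · have := cyl_null N p ρ μ hμ n _ hy
      have := measure_eq_zero_iff_ae_notMem.1 this
      filter_upwards [this] with ω hω _ using hω
    · exact Filter.Eventually.of_forall fun ω h => absurd h hy
  filter_upwards [h] with ω hω t
  by_contra hc
  apply hω t (fun i => ω i) _ (mem_cyl_extZ t ω)
  exact ⟨t, le_rfl, by simpa [extZ] using hc⟩

lemma setIntegral_cyl (N : ℕ) (p ρ : ℝ) (μ : Measure (ℕ → ℕ)) [IsProbabilityMeasure μ]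
    (hμ : ∀ (n : ℕ) (x : ℕ → ℕ),
      μ {ω | ∀ t ≤ n, ω t = x t} =
        ENNReal.ofReal (binomPMF N p (x 0) *
          ∏ t ∈ Finset.Icc 1 n, barK N ρ p (x (t - 1)) (x t)))
    (hp0 : 0 ≤ p) (hp1 : p ≤ 1) (hK : ∀ i j, 0 ≤ barK N ρ p i j)
    (d : ℕ → ℕ → ℝ) (C : ℝ) (hd : ∀ i j, |d i j| ≤ C)
    (hd0 : ∀ i ≤ N, ∑ j ∈ Finset.range (N + 1), barK N ρ p i j * d i j = 0)
    (n : ℕ) (x : ℕ → ℕ) :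
    ∫ ω in cyl n x, d (ω n) (ω (n + 1)) ∂μ = 0 := by
  by_cases hx : ∃ t ≤ n, N < x t
  · rw [Measure.restrict_eq_zero.2 (cyl_null N p ρ μ hμ n x hx), integral_zero_measure]
  push Not at hx
  have hU : cyl n x = ⋃ j : ℕ, cyl (n + 1) (Function.update x (n + 1) j) := by
    ext ω
    simp only [Set.mem_iUnion, cyl, Set.mem_ofPred_eq]
    constructor
    · intro h
      refine ⟨ω (n + 1), fun t ht => ?_⟩
      by_cases h' : t = n + 1
      · subst h'; simp
      · rw [Function.update_of_ne h']; exact h t (by omega)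
    · rintro ⟨j, h⟩ t ht
      have := h t (by omega)
      rwa [Function.update_of_ne (by omega)] at this
  have hmeas : Measurable (fun ω : ℕ → ℕ => d (ω n) (ω (n + 1))) :=
    Measurable.comp (g := fun q : ℕ × ℕ => d q.1 q.2) (f := fun ω : ℕ → ℕ => (ω n, ω (n + 1)))
      (measurable_of_countable _)
      ((measurable_pi_apply n).prodMk (measurable_pi_apply (n + 1)))
  have hint : Integrable (fun ω : ℕ → ℕ => d (ω n) (ω (n + 1))) μ :=
    Integrable.of_bound hmeas.aestronglyMeasurable C
      (Filter.Eventually.of_forall fun ω => hd _ _)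
  rw [hU, integral_iUnion (fun j => measurableSet_cyl _ _) _ hint.integrableOn]
  · set w := binomPMF N p (x 0) * ∏ t ∈ Finset.Icc 1 n, barK N ρ p (x (t - 1)) (x t) with hw
    have hw0 : 0 ≤ w := by
      apply mul_nonneg
      · unfold binomPMF
        have : 0 ≤ 1 - p := by linarith
        positivity
      · exact Finset.prod_nonneg fun t _ => hK _ _
    have hterm : ∀ j, ∫ ω in cyl (n + 1) (Function.update x (n + 1) j),
        d (ω n) (ω (n + 1)) ∂μ = w * (barK N ρ p (x n) j * d (x n) j) := by
      intro j
      have h1 : ∫ ω in cyl (n + 1) (Function.update x (n + 1) j), d (ω n) (ω (n + 1)) ∂μ =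
          ∫ ω in cyl (n + 1) (Function.update x (n + 1) j), d (x n) j ∂μ := by
        apply setIntegral_congr_fun (measurableSet_cyl _ _)
        intro ω hω
        have e1 := hω n (by omega)
        have e2 := hω (n + 1) le_rfl
        rw [Function.update_of_ne (by omega)] at e1
        rw [Function.update_self] at e2
        simp only [e1, e2]
      rw [h1, setIntegral_const, Measure.real]
      have h2 : μ (cyl (n + 1) (Function.update x (n + 1) j)) =
          ENNReal.ofReal (w * barK N ρ p (x n) j) := by
        unfold cyl
        rw [hμ, Finset.prod_Icc_succ_top (by omega)]
        congr 1
        rw [Function.update_of_ne (by omega), Function.update_self, Nat.add_sub_cancel,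
          Function.update_of_ne (by omega), hw, ← mul_assoc]
        congr 2
        apply Finset.prod_congr rfl
        intro t ht
        rw [Finset.mem_Icc] at ht
        rw [Function.update_of_ne (by omega), Function.update_of_ne (by omega)]
      rw [h2, ENNReal.toReal_ofReal (mul_nonneg hw0 (hK _ _)), smul_eq_mul]
      ring
    simp_rw [hterm]
    rw [tsum_eq_sum (s := Finset.range (N + 1)), ← Finset.mul_sum, hd0 _ (hx n le_rfl), mul_zero]
    intro j hj
    rw [barK_zero N ρ p _ _ (hx n le_rfl) (by simpa using hj)]
    simp
  · intro j k hjk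
    rw [Function.onFun, Set.disjoint_left]
    intro ω h1 h2
    apply hjk
    have a := h1 (n + 1) le_rfl
    have b := h2 (n + 1) le_rfl
    rw [Function.update_self] at a b
    exact a.symm.trans b

lemma integral_orth (N : ℕ) (p ρ : ℝ) (μ : Measure (ℕ → ℕ)) [IsProbabilityMeasure μ]
    (hμ : ∀ (n : ℕ) (x : ℕ → ℕ),
      μ {ω | ∀ t ≤ n, ω t = x t} =
        ENNReal.ofReal (binomPMF N p (x 0) *
          ∏ t ∈ Finset.Icc 1 n, barK N ρ p (x (t - 1)) (x t)))
    (hp0 : 0 ≤ p) (hp1 : p ≤ 1) (hK : ∀ i j, 0 ≤ barK N ρ p i j)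
    (d : ℕ → ℕ → ℝ) (C : ℝ) (hd : ∀ i j, |d i j| ≤ C)
    (hd0 : ∀ i ≤ N, ∑ j ∈ Finset.range (N + 1), barK N ρ p i j * d i j = 0)
    (n : ℕ) (g : (ℕ → ℕ) → ℝ) (hg : ∀ ω ω', (∀ t ≤ n, ω t = ω' t) → g ω = g ω')
    (hint : Integrable (fun ω => g ω * d (ω n) (ω (n + 1))) μ) :
    ∫ ω, g ω * d (ω n) (ω (n + 1)) ∂μ = 0 := by
  rw [← setIntegral_univ, ← iUnion_cyl_extZ n,
    integral_iUnion (fun y => measurableSet_cyl _ _) (cyl_extZ_disjoint n) hint.integrableOn]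
  have : ∀ y, ∫ ω in cyl n (extZ n y), g ω * d (ω n) (ω (n + 1)) ∂μ = 0 := by
    intro y
    have h1 : ∫ ω in cyl n (extZ n y), g ω * d (ω n) (ω (n + 1)) ∂μ =
        ∫ ω in cyl n (extZ n y), g (extZ n y) * d (ω n) (ω (n + 1)) ∂μ := by
      apply setIntegral_congr_fun (measurableSet_cyl _ _)
      intro ω hω
      simp only [hg ω _ hω]
    rw [h1, integral_const_mul, setIntegral_cyl N p ρ μ hμ hp0 hp1 hK d C hd hd0, mul_zero]
  simp [this]

lemma slln_bounded (N : ℕ) (p ρ : ℝ) (μ : Measure (ℕ → ℕ)) [IsProbabilityMeasure μ]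
    (hμ : ∀ (n : ℕ) (x : ℕ → ℕ),
      μ {ω | ∀ t ≤ n, ω t = x t} =
        ENNReal.ofReal (binomPMF N p (x 0) *
          ∏ t ∈ Finset.Icc 1 n, barK N ρ p (x (t - 1)) (x t)))
    (hp0 : 0 ≤ p) (hp1 : p ≤ 1) (hK : ∀ i j, 0 ≤ barK N ρ p i j)
    (d : ℕ → ℕ → ℝ) (C : ℝ) (hd : ∀ i j, |d i j| ≤ C)
    (hd0 : ∀ i ≤ N, ∑ j ∈ Finset.range (N + 1), barK N ρ p i j * d i j = 0) :
    ∀ᵐ ω ∂μ, Tendsto (fun n : ℕ => (∑ t ∈ Finset.range n, d (ω t) (ω (t + 1))) / (n : ℝ))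
      atTop (nhds 0) := by
  have hmeas : ∀ n, Measurable (fun ω : ℕ → ℕ => d (ω n) (ω (n + 1))) := fun n =>
    Measurable.comp (g := fun q : ℕ × ℕ => d q.1 q.2) (f := fun ω : ℕ → ℕ => (ω n, ω (n + 1)))
      (measurable_of_countable _)
      ((measurable_pi_apply n).prodMk (measurable_pi_apply (n + 1)))
  have hSm : ∀ n, Measurable (fun ω : ℕ → ℕ => ∑ t ∈ Finset.range n, d (ω t) (ω (t + 1))) :=
    fun n => Finset.measurable_sum _ (fun t _ => hmeas t)
  have hSb : ∀ n (ω : ℕ → ℕ), |∑ t ∈ Finset.range n, d (ω t) (ω (t + 1))| ≤ n * C := by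
    intro n ω
    refine (Finset.abs_sum_le_sum_abs _ _).trans ?_
    refine (Finset.sum_le_sum (fun t _ => hd _ _)).trans ?_
    simp
  have hC0 : 0 ≤ C := (abs_nonneg _).trans (hd 0 0)
  have hi1 : ∀ n, Integrable (fun ω : ℕ → ℕ =>
      (∑ t ∈ Finset.range n, d (ω t) (ω (t + 1))) ^ 2) μ := fun n =>
    Integrable.of_bound ((hSm n).pow_const 2).aestronglyMeasurable ((n * C) ^ 2)
      (Filter.Eventually.of_forall fun ω => by
        rw [norm_pow, Real.norm_eq_abs]
        exact pow_le_pow_left₀ (abs_nonneg _) (hSb n ω) 2)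
  have hi2 : ∀ n, Integrable (fun ω : ℕ → ℕ =>
      (∑ t ∈ Finset.range n, d (ω t) (ω (t + 1))) * d (ω n) (ω (n + 1))) μ := fun n =>
    Integrable.of_bound ((hSm n).mul (hmeas n)).aestronglyMeasurable ((n * C) * C)
      (Filter.Eventually.of_forall fun ω => by
        rw [norm_mul, Real.norm_eq_abs, Real.norm_eq_abs]
        exact mul_le_mul (hSb n ω) (hd _ _) (abs_nonneg _) (by positivity))
  have hi3 : ∀ n, Integrable (fun ω : ℕ → ℕ => d (ω n) (ω (n + 1)) ^ 2) μ := fun n =>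
    Integrable.of_bound ((hmeas n).pow_const 2).aestronglyMeasurable (C ^ 2)
      (Filter.Eventually.of_forall fun ω => by
        rw [norm_pow, Real.norm_eq_abs]
        exact pow_le_pow_left₀ (abs_nonneg _) (hd _ _) 2)
  refine slln_of_second_moment μ (fun t ω => d (ω t) (ω (t + 1))) hmeas C (fun t ω => hd _ _)
    hi1 ?_
  intro n
  induction n with
  | zero => simp
  | succ n ih =>
    have e : ∀ ω : ℕ → ℕ, (∑ t ∈ Finset.range (n + 1), d (ω t) (ω (t + 1))) ^ 2 =
        ((∑ t ∈ Finset.range n, d (ω t) (ω (t + 1))) ^ 2 +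
          2 * ((∑ t ∈ Finset.range n, d (ω t) (ω (t + 1))) * d (ω n) (ω (n + 1)))) +
          d (ω n) (ω (n + 1)) ^ 2 := by
      intro ω; rw [Finset.sum_range_succ]; ring
    simp_rw [e]
    have hi12 : Integrable (fun ω : ℕ → ℕ => (∑ t ∈ Finset.range n, d (ω t) (ω (t + 1))) ^ 2 +
        2 * ((∑ t ∈ Finset.range n, d (ω t) (ω (t + 1))) * d (ω n) (ω (n + 1)))) μ :=
      (hi1 n).add ((hi2 n).const_mul 2)
    rw [integral_add hi12 (hi3 n),
      integral_add (hi1 n) ((hi2 n).const_mul 2), integral_const_mul,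
      integral_orth N p ρ μ hμ hp0 hp1 hK d C hd hd0 n _ _ (hi2 n)]
    · have h3 : ∫ ω : ℕ → ℕ, d (ω n) (ω (n + 1)) ^ 2 ∂μ ≤ C ^ 2 := by
        have := integral_mono (hi3 n) (integrable_const (C ^ 2)) (fun ω => by
          have := pow_le_pow_left₀ (abs_nonneg _) (hd (ω n) (ω (n + 1))) 2
          simpa using this)
        simpa using this
      push_cast
      linarith
    · intro ω ω' h
      apply Finset.sum_congr rfl
      intro t ht
      rw [Finset.mem_range] at ht
      rw [h t (by omega), h (t + 1) (by omega)]

lemma slln_mds (N : ℕ) (p ρ : ℝ) (μ : Measure (ℕ → ℕ)) [IsProbabilityMeasure μ]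
    (hμ : ∀ (n : ℕ) (x : ℕ → ℕ),
      μ {ω | ∀ t ≤ n, ω t = x t} =
        ENNReal.ofReal (binomPMF N p (x 0) *
          ∏ t ∈ Finset.Icc 1 n, barK N ρ p (x (t - 1)) (x t)))
    (hp0 : 0 ≤ p) (hp1 : p ≤ 1) (hK : ∀ i j, 0 ≤ barK N ρ p i j)
    (d : ℕ → ℕ → ℝ)
    (hd0 : ∀ i ≤ N, ∑ j ∈ Finset.range (N + 1), barK N ρ p i j * d i j = 0) :
    ∀ᵐ ω ∂μ, Tendsto (fun n : ℕ => (∑ t ∈ Finset.range n, d (ω t) (ω (t + 1))) / (n : ℝ))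
      atTop (nhds 0) := by
  have h := slln_bounded N p ρ μ hμ hp0 hp1 hK
    (fun i j => if i ≤ N ∧ j ≤ N then d i j else 0)
    (∑ i ∈ Finset.range (N + 1), ∑ j ∈ Finset.range (N + 1), |d i j|) ?_ ?_
  · filter_upwards [h, ae_le_N N p ρ μ hμ] with ω h1 h2
    simpa [h2] using h1
  · intro i j
    split_ifs with hij
    · refine le_trans ?_ (Finset.single_le_sum (f := fun i => ∑ j ∈ Finset.range (N + 1), |d i j|)
        (fun i _ => Finset.sum_nonneg fun j _ => abs_nonneg _)
        (Finset.mem_range.2 (Nat.lt_succ_of_le hij.1)))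
      exact Finset.single_le_sum (f := fun j => |d i j|) (fun j _ => abs_nonneg _)
        (Finset.mem_range.2 (Nat.lt_succ_of_le hij.2))
    · rw [abs_zero]
      exact Finset.sum_nonneg fun i _ => Finset.sum_nonneg fun j _ => abs_nonneg _
  · intro i hi
    rw [← hd0 i hi]
    apply Finset.sum_congr rfl
    intro j hj
    rw [if_pos ⟨hi, Nat.le_of_lt_succ (Finset.mem_range.1 hj)⟩]

lemma sum_Icc_shift (f : ℕ → ℕ → ℝ) (n : ℕ) :
    ∑ t ∈ Finset.Icc 1 n, f (t - 1) t = ∑ t ∈ Finset.range n, f t (t + 1) := by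
  induction n with
  | zero => simp
  | succ n ih => rw [Finset.sum_Icc_succ_top (by omega), ih, Finset.sum_range_succ]; simp

/-- Deterministic part. -/
lemma cls_det (N : ℕ) (hN : 1 ≤ N) (p ρ : ℝ) (hp0 : 0 < p) (hp1 : p < 1)
    (hρ1 : -1 < ρ) (hρu : ρ < 1) (x : ℕ → ℝ) (hx : ∀ t, |x t| ≤ N) (a b : ℝ)
    (hab : a * (N * p) + b = (1 - ρ ^ 2) * (N * p * (1 - p) + (N * p) ^ 2))
    (h1 : Tendsto (fun n : ℕ =>
      (∑ t ∈ Finset.range n, (x (t + 1) - ρ * x t - N * p * (1 - ρ))) / (n : ℝ)) atTop (nhds 0))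
    (h2 : Tendsto (fun n : ℕ =>
      (∑ t ∈ Finset.range n, (x (t + 1) ^ 2 - ρ ^ 2 * x t ^ 2 - a * x t - b)) / (n : ℝ))
      atTop (nhds 0))
    (h3 : Tendsto (fun n : ℕ =>
      (∑ t ∈ Finset.range n, (x t * (x (t + 1) - ρ * x t - N * p * (1 - ρ)))) / (n : ℝ))
      atTop (nhds 0)) :
    Tendsto (fun n : ℕ => clsRho x n) atTop (nhds ρ) ∧
      Tendsto (fun n : ℕ => clsP N x n) atTop (nhds p) := by
  have hNR : (1 : ℝ) ≤ N := by exact_mod_cast hN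
  set M : ℝ := N * p with hM
  set V : ℝ := N * p * (1 - p) + (N * p) ^ 2 with hV
  set A : ℕ → ℝ := fun n => (∑ t ∈ Finset.range n, x t) / n with hA
  set A' : ℕ → ℝ := fun n => (∑ t ∈ Finset.range n, x (t + 1)) / n with hA'
  set B : ℕ → ℝ := fun n => (∑ t ∈ Finset.range n, x t ^ 2) / n with hB
  set E : ℕ → ℝ := fun n => (∑ t ∈ Finset.range n, x (t + 1) * x t) / n with hE
  have tele : ∀ (y : ℕ → ℝ) (n : ℕ), ∑ t ∈ Finset.range n, y (t + 1) =
      ∑ t ∈ Finset.range n, y t + (y n - y 0) := by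
    intro y n
    rw [← Finset.sum_range_sub y n, ← Finset.sum_add_distrib]
    simp
  have bdd : ∀ (y : ℕ → ℝ) (R : ℝ), (∀ t, |y t| ≤ R) →
      Tendsto (fun n : ℕ => (y n - y 0) / (n : ℝ)) atTop (nhds 0) := by
    intro y R hy
    apply squeeze_zero_norm _ (tendsto_const_div_atTop_nhds_zero_nat (2 * R))
    intro n
    rw [norm_div, Real.norm_eq_abs, Real.norm_natCast]
    gcongr
    have := abs_sub (y n) (y 0)
    linarith [hy n, hy 0]
  have r1 := bdd x N hx
  have r2 := bdd (fun t => x t ^ 2) (N ^ 2) (fun t => by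
    rw [abs_pow]; exact pow_le_pow_left₀ (abs_nonneg _) (hx t) 2)
  have hAlim : Tendsto A atTop (nhds M) := by
    have := (((h1.sub r1).div_const (1 - ρ)).add_const M)
    simp only [sub_zero, zero_div, zero_add] at this
    refine this.congr' ?_
    filter_upwards [eventually_ge_atTop 1] with n hn
    have hn0 : (n : ℝ) ≠ 0 := by positivity
    have : (1 - ρ) ≠ 0 := by linarith
    simp only [hA, Finset.sum_sub_distrib, tele x n, ← Finset.mul_sum, Finset.sum_const,
      Finset.card_range, nsmul_eq_mul]
    field_simp
    ring
  have hA'lim : Tendsto A' atTop (nhds M) := by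
    have := hAlim.add r1
    rw [add_zero] at this
    refine this.congr (fun n => ?_)
    simp only [hA, hA', tele x n, add_div]
  have hρ2 : 1 - ρ ^ 2 ≠ 0 := by nlinarith
  have hBlim : Tendsto B atTop (nhds V) := by
    have := ((((h2.sub r2).add (hAlim.const_mul a)).add_const b).div_const (1 - ρ ^ 2))
    have e : (0 - 0 + a * M + b) / (1 - ρ ^ 2) = V := by
      rw [div_eq_iff hρ2]; linarith
    rw [e] at this
    refine this.congr' ?_
    filter_upwards [eventually_ge_atTop 1] with n hn
    have hn0 : (n : ℝ) ≠ 0 := by positivity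
    simp only [hA, hB, Finset.sum_sub_distrib, tele (fun t => x t ^ 2) n, ← Finset.mul_sum,
      Finset.sum_const, Finset.card_range, nsmul_eq_mul]
    field_simp
    ring
  have hElim : Tendsto E atTop (nhds (ρ * V + M * (1 - ρ) * M)) := by
    have := (h3.add (hBlim.const_mul ρ)).add (hAlim.const_mul (M * (1 - ρ)))
    rw [zero_add] at this
    refine this.congr (fun n => ?_)
    simp only [hA, hB, hE, Finset.mul_sum, ← mul_div_assoc, ← add_div, ← Finset.sum_add_distrib]
    congr 1
    apply Finset.sum_congr rfl
    intro t _
    ring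
  have hden : V - M ^ 2 ≠ 0 := by
    have : 0 < N * p * (1 - p) := by
      have : 0 < 1 - p := by linarith
      positivity
    rw [hV, hM]
    linarith
  have hR : Tendsto (fun n : ℕ => clsRho x n) atTop (nhds ρ) := by
    have := (hElim.sub (hA'lim.mul hAlim)).div (hBlim.sub (hAlim.pow 2)) hden
    have e : (ρ * V + M * (1 - ρ) * M - M * M) / (V - M ^ 2) = ρ := by
      rw [div_eq_iff hden]; ring
    rw [e] at this
    refine this.congr' ?_
    filter_upwards [eventually_ge_atTop 1] with n hn
    have hn0 : (n : ℝ) ≠ 0 := by positivity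
    unfold clsRho
    rw [sum_Icc_shift (fun s t => x t * x s), sum_Icc_shift (fun s t => x t),
      sum_Icc_shift (fun s t => x s), sum_Icc_shift (fun s t => x s ^ 2)]
    change (E n - A' n * A n) / (B n - A n ^ 2) = _
    rw [← mul_div_mul_left (E n - A' n * A n) _ (pow_ne_zero 2 hn0)]
    simp only [hA, hA', hB, hE]
    congr 1 <;> field_simp
  refine ⟨hR, ?_⟩
  have hden2 : (N : ℝ) * (1 - ρ) ≠ 0 := by
    have : 0 < 1 - ρ := by linarith
    positivity
  have := (hA'lim.sub (hR.mul hAlim)).div ((hR.const_sub 1).const_mul (N : ℝ)) hden2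
  have e : (M - ρ * M) / (N * (1 - ρ)) = p := by
    rw [div_eq_iff hden2, hM]; ring
  rw [e] at this
  refine this.congr' ?_
  filter_upwards [eventually_ge_atTop 1] with n hn
  have hn0 : (n : ℝ) ≠ 0 := by positivity
  unfold clsP
  rw [sum_Icc_shift (fun s t => x t), sum_Icc_shift (fun s t => x s),
    mul_assoc]
  change (A' n - clsRho x n * A n) / (N * (1 - clsRho x n)) = _
  rw [← mul_div_mul_left (A' n - clsRho x n * A n) _ hn0]
  simp only [hA, hA']
  congr 1
  field_simp

end Helpers

/-- **Strong consistency of the CLS estimator.**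
For the canonical stationary BAR(1) chain with trajectory law `μ`, the CLS estimators
computed from `X_0, …, X_n` converge μ-almost surely to the true parameters `(ρ, p)`. -/
theorem cls_strong_consistency
    (N : ℕ) (hN : 1 ≤ N) (p ρ : ℝ) (hp0 : 0 < p) (hp1 : p < 1)
    (hρl : max (-(p / (1 - p))) (-((1 - p) / p)) < ρ) (hρu : ρ < 1)
    (μ : Measure (ℕ → ℕ)) [IsProbabilityMeasure μ]
    (hμ : ∀ (n : ℕ) (x : ℕ → ℕ),
      μ {ω | ∀ t ≤ n, ω t = x t} =
        ENNReal.ofReal (binomPMF N p (x 0) *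
          ∏ t ∈ Finset.Icc 1 n, barK N ρ p (x (t - 1)) (x t))) :
    ∀ᵐ ω ∂μ,
      Tendsto (fun n : ℕ => clsRho (xR ω) n) atTop (nhds ρ) ∧
      Tendsto (fun n : ℕ => clsP N (xR ω) n) atTop (nhds p) := by
  have hq : 0 < 1 - p := by linarith
  have l1 : -(p / (1 - p)) < ρ := (le_max_left _ _).trans_lt hρl
  have l2 : -((1 - p) / p) < ρ := (le_max_right _ _).trans_lt hρl
  have hα : 0 < p * (1 - ρ) + ρ := by
    have := mul_lt_mul_of_pos_right l1 hq
    rw [neg_mul, div_mul_cancel₀ _ hq.ne'] at this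
    linarith
  have hβ : 0 < 1 - p * (1 - ρ) := by
    have := mul_lt_mul_of_pos_right l2 hp0
    rw [neg_mul, div_mul_cancel₀ _ hp0.ne'] at this
    linarith
  have hβ0 : 0 < p * (1 - ρ) := mul_pos hp0 (by linarith)
  have hα1 : 0 < 1 - (p * (1 - ρ) + ρ) := by nlinarith [mul_pos hq (sub_pos.2 hρu)]
  have hρ1 : -1 < ρ := by linarith
  have hK : ∀ i j, 0 ≤ barK N ρ p i j := fun i j =>
    barK_nonneg N ρ p i j hα.le hα1.le hβ0.le hβ.le
  set a : ℝ := -(p * (1 - ρ) + ρ) ^ 2 + 2 * N * (p * (1 - ρ) + ρ) * (p * (1 - ρ))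
    - (2 * N - 1) * (p * (1 - ρ)) ^ 2 + ρ with ha
  set b : ℝ := N * (N - 1) * (p * (1 - ρ)) ^ 2 + N * (p * (1 - ρ)) with hb
  have m1 : ∀ i ≤ N, ∑ j ∈ Finset.range (N + 1),
      barK N ρ p i j * ((j : ℝ) - ρ * i - N * p * (1 - ρ)) = 0 := by
    intro i hi
    have e : ∀ j ∈ Finset.range (N + 1), barK N ρ p i j * ((j : ℝ) - ρ * i - N * p * (1 - ρ)) =
        barK N ρ p i j * (j : ℝ) - barK N ρ p i j * (ρ * i + N * p * (1 - ρ)) := by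
      intro j _; ring
    rw [Finset.sum_congr rfl e, Finset.sum_sub_distrib, ← Finset.sum_mul, barK_sum _ _ _ _ hi,
      barK_sum1 _ _ _ _ hi]
    ring
  have m2 : ∀ i ≤ N, ∑ j ∈ Finset.range (N + 1),
      barK N ρ p i j * ((j : ℝ) ^ 2 - ρ ^ 2 * (i : ℝ) ^ 2 - a * i - b) = 0 := by
    intro i hi
    have e : ∀ j ∈ Finset.range (N + 1),
        barK N ρ p i j * ((j : ℝ) ^ 2 - ρ ^ 2 * (i : ℝ) ^ 2 - a * i - b) =
        barK N ρ p i j * ((j : ℝ) ^ 2 - j) + barK N ρ p i j * (j : ℝ)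
          - barK N ρ p i j * (ρ ^ 2 * (i : ℝ) ^ 2 + a * i + b) := by
      intro j _; ring
    rw [Finset.sum_congr rfl e, Finset.sum_sub_distrib, Finset.sum_add_distrib, ← Finset.sum_mul,
      barK_sum _ _ _ _ hi, barK_sum1 _ _ _ _ hi, barK_sum2 _ _ _ _ hi, ha, hb]
    ring
  have m3 : ∀ i ≤ N, ∑ j ∈ Finset.range (N + 1),
      barK N ρ p i j * ((i : ℝ) * ((j : ℝ) - ρ * i - N * p * (1 - ρ))) = 0 := by
    intro i hi
    have := congrArg (fun z => (i : ℝ) * z) (m1 i hi)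
    simp only [mul_zero, Finset.mul_sum] at this
    rw [← this]
    exact Finset.sum_congr rfl fun j _ => by ring
  filter_upwards [ae_le_N N p ρ μ hμ,
    slln_mds N p ρ μ hμ hp0.le hp1.le hK _ m1,
    slln_mds N p ρ μ hμ hp0.le hp1.le hK _ m2,
    slln_mds N p ρ μ hμ hp0.le hp1.le hK _ m3] with ω h0 h1 h2 h3
  refine cls_det N hN p ρ hp0 hp1 hρ1 hρu (xR ω) ?_ a b ?_ h1 h2 h3
  · intro t
    simpa [xR] using h0 t
  · rw [ha, hb]; ring
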